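/- The code C_{(m,r)} over F_{q^r} with parity check matrix H_m (Hamming parity check matrix over F_q, length n = (q^m−1)/(q−1)) is completely regular with covering radius ρ = min{r,m} and intersection numbers b_i = (q^r−q^i)(q^m−q^i)/(q−1) for 0 ≤ i ≤ ρ−1 and c_i = q^{i−1}(q^i−1)/(q−1) for 1 ≤ i ≤ ρ. -/

import Mathlib

/-- Distance from a vector to a code (minimum Hamming distance to a codeword). -/
noncomputable def distToCode {n : ℕ} {K : Type*} [DecidableEq K] (C : Set (Fin n → K)) (v : Fin n → K) : ℕ :=
  sInf {d : ℕ | ∃ c ∈ C, hammingDist v c = d}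

section LinAlg
open Module

variable {F V W : Type} [Field F] [AddCommGroup V] [Module F V] [AddCommGroup W] [Module F W]

noncomputable def lhRk (φ : V →ₗ[F] W) : ℕ := Module.finrank F (LinearMap.range φ)

lemma lh_up_iff [FiniteDimensional F V] [FiniteDimensional F W] (φ : V →ₗ[F] W) (w : W)
    (f : Dual F V) :
    lhRk (φ + f.smulRight w) = lhRk φ + 1 ↔
      w ∉ LinearMap.range φ ∧ f ∉ (LinearMap.ker φ).dualAnnihilator := by
  unfold lhRk
  constructor
  · intro h
    constructor
    · intro hw
      have : LinearMap.range (φ + f.smulRight w) ≤ LinearMap.range φ := by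
        rintro _ ⟨v, rfl⟩
        exact Submodule.add_mem _ ⟨v, rfl⟩ (Submodule.smul_mem _ _ hw)
      have := Submodule.finrank_mono this
      omega
    · intro hf
      rw [Submodule.mem_dualAnnihilator] at hf
      have : LinearMap.ker φ ≤ LinearMap.ker (φ + f.smulRight w) := by
        intro v hv
        have h1 := hf v hv
        rw [LinearMap.mem_ker] at hv ⊢
        simp [hv, h1]
      have := Submodule.finrank_mono this
      have h1 := LinearMap.finrank_range_add_finrank_ker φ
      have h2 := LinearMap.finrank_range_add_finrank_ker (φ + f.smulRight w)
      omega
  · rintro ⟨hw, hf⟩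
    rw [Submodule.mem_dualAnnihilator] at hf
    push Not at hf
    obtain ⟨v, hv, hfv⟩ := hf
    rw [LinearMap.mem_ker] at hv
    rw [← Submodule.finrank_sup_span_singleton hw]
    have hmem : w ∈ LinearMap.range (φ + f.smulRight w) :=
      ⟨(f v)⁻¹ • v, by simp [hv, smul_smul, hfv]⟩
    suffices hs : LinearMap.range (φ + f.smulRight w) =
        LinearMap.range φ ⊔ Submodule.span F {w} by rw [hs]
    apply le_antisymm
    · rintro _ ⟨u, rfl⟩
      exact Submodule.add_mem_sup ⟨u, rfl⟩
        (Submodule.smul_mem _ _ (Submodule.mem_span_singleton_self w))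
    · refine sup_le ?_ ?_
      · rintro _ ⟨u, rfl⟩
        have : φ u = (φ + f.smulRight w) u - f u • w := by simp
        rw [this]
        exact Submodule.sub_mem _ ⟨u, rfl⟩ (Submodule.smul_mem _ _ hmem)
      · rw [Submodule.span_singleton_le_iff_mem]
        exact hmem

lemma lh_down_iff [FiniteDimensional F V] [FiniteDimensional F W] (φ : V →ₗ[F] W) (w : W)
    (f : Dual F V) :
    lhRk (φ + f.smulRight w) + 1 = lhRk φ ↔
      f ∈ (LinearMap.ker φ).dualAnnihilator ∧ ∃ u, φ u = w ∧ f u = -1 := by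
  have key := lh_up_iff (φ + f.smulRight w) (-w) f
  have e : φ + f.smulRight w + f.smulRight (-w) = φ := by
    ext v; simp
  rw [e] at key
  rw [eq_comm, key]
  simp only [Submodule.mem_dualAnnihilator, neg_mem_iff]
  push Not
  constructor
  · rintro ⟨hw, v, hv, hfv⟩
    rw [LinearMap.mem_ker] at hv
    refine ⟨fun u hu => ?_, -(f v)⁻¹ • v, ?_, ?_⟩
    · by_contra hfu
      apply hw
      rw [LinearMap.mem_ker] at hu
      exact ⟨(f u)⁻¹ • u, by simp [hu, smul_smul, hfu]⟩
    · have : φ v = - (f v • w) := by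
        rw [eq_neg_iff_add_eq_zero]; simpa using hv
      simp [this, smul_smul, hfv]
    · simp [hfv]
  · rintro ⟨hf, u, hu, hfu⟩
    refine ⟨?_, u, ?_, ?_⟩
    · rintro ⟨v, hv⟩
      have := hf (v + f v • u - u) (by
        rw [LinearMap.mem_ker]
        simp only [LinearMap.add_apply, LinearMap.smulRight_apply] at hv
        simp [hu, hv])
      simp [hfu] at this
    · rw [LinearMap.mem_ker]; simp [hu, hfu]
    · simp [hfu]

lemma lh_ann_finrank [FiniteDimensional F V] (φ : V →ₗ[F] W) :
    finrank F (LinearMap.ker φ).dualAnnihilator = lhRk φ := by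
  have h1 := LinearMap.finrank_range_add_finrank_ker φ
  have h2 := Subspace.finrank_add_finrank_dualAnnihilator_eq (LinearMap.ker φ)
  unfold lhRk
  omega

lemma lh_card_compl [Finite F] [FiniteDimensional F W] (S : Submodule F W) :
    Nat.card {w : W // w ∉ S} = Nat.card F ^ finrank F W - Nat.card F ^ finrank F S := by
  classical
  have : Finite W := Module.finite_of_finite F
  have := Fintype.ofFinite W
  rw [← Module.natCard_eq_pow_finrank (K := F) (V := W),
    ← Module.natCard_eq_pow_finrank (K := F) (V := S)]
  simp only [Nat.card_eq_fintype_card]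
  exact Fintype.card_subtype_compl (fun w => w ∈ S)

lemma lh_card_up [Finite F] [FiniteDimensional F V] [FiniteDimensional F W] (φ : V →ₗ[F] W) :
    Nat.card {p : W × Dual F V // lhRk (φ + p.2.smulRight p.1) = lhRk φ + 1} =
      (Nat.card F ^ finrank F W - Nat.card F ^ lhRk φ) *
      (Nat.card F ^ finrank F V - Nat.card F ^ lhRk φ) := by
  simp only [lh_up_iff]
  rw [Nat.card_congr (Equiv.subtypeProdEquivProd (p := fun w => w ∉ LinearMap.range φ)
    (q := fun f => f ∉ (LinearMap.ker φ).dualAnnihilator)), Nat.card_prod, lh_card_compl,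
    lh_card_compl, lh_ann_finrank, Subspace.dual_finrank_eq]
  rfl

lemma lh_card_affine {A : Type} [AddCommGroup A] [Module F A] [Finite F] [FiniteDimensional F A]
    (ev : A →ₗ[F] F) (g0 : A) (hg0 : ev g0 = -1) :
    Nat.card {a : A // ev a = -1} = Nat.card F ^ (finrank F A - 1) := by
  have hsurj : LinearMap.range ev = ⊤ := by
    rw [LinearMap.range_eq_top]
    intro c
    refine ⟨(-c) • g0, by rw [map_smul, hg0]; simp⟩
  have hk := LinearMap.finrank_range_add_finrank_ker ev
  rw [hsurj, finrank_top, Module.finrank_self] at hk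
  have hk' : finrank F (LinearMap.ker ev) = finrank F A - 1 := by omega
  rw [← hk', ← Module.natCard_eq_pow_finrank]
  refine Nat.card_congr ⟨fun f => ⟨f.1 - g0, ?_⟩, fun k => ⟨k.1 + g0, ?_⟩, ?_, ?_⟩
  · rw [LinearMap.mem_ker, map_sub, hg0, f.2, sub_self]
  · rw [map_add, hg0, LinearMap.mem_ker.1 k.2, zero_add]
  · intro f; ext1; simp
  · intro k; ext1; simp

lemma lh_card_fiber [Finite F] [FiniteDimensional F V] (φ : V →ₗ[F] W) (w : W)
    (hw : w ∈ LinearMap.range φ) (hw0 : w ≠ 0) :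
    Nat.card {f : Dual F V //
      f ∈ (LinearMap.ker φ).dualAnnihilator ∧ ∃ u, φ u = w ∧ f u = -1} =
      Nat.card F ^ (lhRk φ - 1) := by
  obtain ⟨u, hu⟩ := hw
  have hnk : u ∉ LinearMap.ker φ := by
    rw [LinearMap.mem_ker, hu]; exact hw0
  obtain ⟨g, hgu, hg⟩ := Submodule.exists_le_ker_of_notMem hnk
  let A : Submodule F (Dual F V) := (LinearMap.ker φ).dualAnnihilator
  let ev : A →ₗ[F] F := (LinearMap.applyₗ u).comp A.subtype
  have hev : ∀ f : A, ev f = f.1 u := fun f => rfl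
  have hgA : g ∈ A := by
    rw [Submodule.mem_dualAnnihilator]
    exact fun v hv => hg hv
  let g0 : A := (-(g u)⁻¹) • ⟨g, hgA⟩
  have hg0 : ev g0 = -1 := by simp [hev, g0, hgu]
  have huniq : ∀ f ∈ A, ∀ v, φ v = w → f v = f u := by
    intro f hf v hv
    have := (Submodule.mem_dualAnnihilator f).1 hf (v - u) (by
      rw [LinearMap.mem_ker]; simp [hv, hu])
    rw [map_sub] at this
    exact sub_eq_zero.1 this
  have hcard := lh_card_affine (F := F) (A := A) ev g0 hg0
  rw [lh_ann_finrank] at hcard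
  rw [← hcard]
  refine Nat.card_congr ⟨fun f => ⟨⟨f.1, f.2.1⟩, ?_⟩, fun k => ⟨k.1.1, k.1.2, u, hu, k.2⟩,
    fun f => rfl, fun k => rfl⟩
  obtain ⟨f, hf, v, hv, hfv⟩ := f
  show f u = -1
  rw [← huniq f hf v hv, hfv]

lemma lh_card_down [Finite F] [FiniteDimensional F V] [FiniteDimensional F W] (φ : V →ₗ[F] W) :
    Nat.card {p : W × Dual F V // lhRk (φ + p.2.smulRight p.1) + 1 = lhRk φ} =
      (Nat.card F ^ lhRk φ - 1) * Nat.card F ^ (lhRk φ - 1) := by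
  classical
  have : Finite W := Module.finite_of_finite F
  have := Fintype.ofFinite W
  have : Finite (Dual F V) := Module.finite_of_finite F
  simp only [lh_down_iff]
  let B := {w : LinearMap.range φ // w ∉ (⊥ : Submodule F (LinearMap.range φ))}
  have hB : Nat.card B = Nat.card F ^ lhRk φ - 1 := by
    show Nat.card {w : LinearMap.range φ // w ∉ (⊥ : Submodule F (LinearMap.range φ))} = _
    rw [lh_card_compl]; simp [lhRk]
  let e : {p : W × Dual F V // p.2 ∈ (LinearMap.ker φ).dualAnnihilator ∧
      ∃ u, φ u = p.1 ∧ p.2 u = -1} ≃ Σ b : B, {f : Dual F V //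
      f ∈ (LinearMap.ker φ).dualAnnihilator ∧ ∃ u, φ u = b.1.1 ∧ f u = -1} :=
    { toFun := fun p => ⟨⟨⟨p.1.1, by
          obtain ⟨p, h, u, hu, -⟩ := p
          exact ⟨u, hu⟩⟩, by
          obtain ⟨p, h, u, hu, h1⟩ := p
          intro h0
          rw [Submodule.mem_bot, Subtype.ext_iff] at h0
          simp only [ZeroMemClass.coe_zero] at h0
          rw [h0] at hu
          have := (Submodule.mem_dualAnnihilator _).1 h u hu
          rw [this] at h1
          simp at h1⟩, ⟨p.1.2, p.2⟩⟩
      invFun := fun s => ⟨(s.1.1.1, s.2.1), s.2.2⟩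
      left_inv := fun p => rfl
      right_inv := fun s => rfl }
  have : Fintype B := Fintype.ofFinite B
  rw [Nat.card_congr e, Nat.card_sigma, Finset.sum_congr rfl (fun b _ => lh_card_fiber φ b.1.1 b.1.2
    (fun h => b.2 (by rw [Submodule.mem_bot]; exact Subtype.ext h)))]
  rw [Finset.sum_const, Finset.card_univ, ← Nat.card_eq_fintype_card, hB, smul_eq_mul]

end LinAlg

section Code
open Module

variable {F V K : Type} [Field F] [AddCommGroup V] [Module F V] [Field K] [Algebra F K] {n : ℕ}

noncomputable def lhT (f : Fin n → Dual F V) (x : Fin n → K) : V →ₗ[F] K :=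
  ∑ j, (f j).smulRight (x j)

lemma lhT_apply (f : Fin n → Dual F V) (x : Fin n → K) (v : V) :
    lhT f x v = ∑ j, f j v • x j := by
  simp [lhT, LinearMap.sum_apply]

lemma lhT_add_single (f : Fin n → Dual F V) (x : Fin n → K) (j : Fin n) (a : K) :
    lhT f (x + Pi.single j a) = lhT f x + (f j).smulRight a := by
  ext v
  simp [lhT_apply, smul_add, Finset.sum_add_distrib, Pi.single_apply]

lemma lhT_sub (f : Fin n → Dual F V) (x y : Fin n → K) :
    lhT f (-x + y) = -lhT f x + lhT f y := by
  ext v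
  simp [lhT_apply, Finset.sum_add_distrib]

lemma lhRk_le_norm [DecidableEq K] [FiniteDimensional F K] (f : Fin n → Dual F V)
    (x : Fin n → K) : lhRk (lhT f x) ≤ hammingNorm x := by
  classical
  let s : Finset (Fin n) := Finset.univ.filter (fun i => x i ≠ 0)
  have h1 : LinearMap.range (lhT f x) ≤ Submodule.span F ((s.image x : Finset K) : Set K) := by
    rintro _ ⟨v, rfl⟩
    rw [lhT_apply]
    refine Submodule.sum_mem _ fun j _ => ?_
    by_cases hj : x j = 0
    · rw [hj, smul_zero]; exact Submodule.zero_mem _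
    · refine Submodule.smul_mem _ _ (Submodule.subset_span ?_)
      simp only [Finset.coe_image]
      exact ⟨j, by simp [s, hj], rfl⟩
  calc lhRk (lhT f x) ≤ _ := Submodule.finrank_mono h1
    _ ≤ (s.image x).card := finrank_span_finset_le_card _
    _ ≤ s.card := Finset.card_image_le
    _ = hammingNorm x := rfl

lemma lhRk_eq_zero [FiniteDimensional F K] (φ : V →ₗ[F] K) : lhRk φ = 0 ↔ φ = 0 := by
  rw [lhRk, Submodule.finrank_eq_zero, LinearMap.range_eq_bot]

lemma lh_hammingDist_single [DecidableEq K] (x : Fin n → K) (j : Fin n) {a : K} (ha : a ≠ 0) :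
    hammingDist x (x + Pi.single j a) = 1 := by
  unfold hammingDist
  rw [Finset.card_eq_one]
  refine ⟨j, ?_⟩
  ext i
  by_cases h : i = j
  · subst h; simp [ha]
  · simp [h]

lemma lh_hammingDist_one [DecidableEq K] (x y : Fin n → K) (h : hammingDist x y = 1) :
    ∃ j a, a ≠ 0 ∧ y = x + Pi.single j a := by
  unfold hammingDist at h
  rw [Finset.card_eq_one] at h
  obtain ⟨j, hj⟩ := h
  have hmem : ∀ i, x i ≠ y i ↔ i = j := by
    intro i
    have := Finset.ext_iff.1 hj i
    simpa using this
  refine ⟨j, y j - x j, sub_ne_zero.2 ((hmem j).2 rfl).symm, ?_⟩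
  ext i
  by_cases h : i = j
  · subst h; simp
  · have := mt (hmem i).1 h
    push Not at this
    simp [h, this]

lemma lh_card_nbr [DecidableEq K] (x : Fin n → K) (P : (Fin n → K) → Prop) :
    Nat.card {y : Fin n → K // hammingDist x y = 1 ∧ P y} =
      Nat.card {p : Fin n × K // p.2 ≠ 0 ∧ P (x + Pi.single p.1 p.2)} := by
  symm
  refine Nat.card_eq_of_bijective
    (fun p => ⟨x + Pi.single p.1.1 p.1.2, lh_hammingDist_single x _ p.2.1, p.2.2⟩) ⟨?_, ?_⟩
  · rintro ⟨⟨j, a⟩, ha, _⟩ ⟨⟨j', a'⟩, ha', _⟩ h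
    simp only [Subtype.mk.injEq, add_right_inj] at h
    have h1 := congr_fun h j
    simp only at ha ha'
    by_cases hj : j = j'
    · subst hj
      simp at h1
      simp [h1]
    · simp [hj] at h1
      exact absurd h1 ha
  · rintro ⟨y, hy, hP⟩
    obtain ⟨j, a, ha, rfl⟩ := lh_hammingDist_one x y hy
    exact ⟨⟨(j, a), ha, hP⟩, rfl⟩

/-- The family `f` represents every point of the projective space of the dual exactly once. -/
structure LhProj (f : Fin n → Dual F V) : Prop where
  ne : ∀ j, f j ≠ 0
  ex : ∀ g : Dual F V, g ≠ 0 → ∃ (c : Fˣ) (j : Fin n), g = c • f j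
  un : ∀ (c c' : Fˣ) (j j' : Fin n), c • f j = c' • f j' → c = c' ∧ j = j'

lemma lh_smulRight (c : Fˣ) (g : Dual F V) (a : K) :
    (c • g).smulRight (c⁻¹ • a) = g.smulRight a := by
  ext v
  simp [Units.smul_def, smul_smul, mul_comm]

lemma lh_card_mul [DecidableEq K] (f : Fin n → Dual F V) (hf : LhProj f) (x : Fin n → K)
    (Q : (V →ₗ[F] K) → Prop) (hQ : ¬ Q (lhT f x)) :
    Nat.card Fˣ * Nat.card {y : Fin n → K // hammingDist x y = 1 ∧ Q (lhT f y)} =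
      Nat.card {p : K × Dual F V // Q (lhT f x + p.2.smulRight p.1)} := by
  rw [lh_card_nbr x (fun y => Q (lhT f y)), ← Nat.card_prod]
  simp only [lhT_add_single]
  refine Nat.card_eq_of_bijective
    (fun t => ⟨(t.1⁻¹ • t.2.1.2, t.1 • f t.2.1.1), by
      simp only [lh_smulRight]; exact t.2.2.2⟩) ⟨?_, ?_⟩
  · rintro ⟨c, ⟨⟨j, a⟩, ha, _⟩⟩ ⟨c', ⟨⟨j', a'⟩, ha', _⟩⟩ h
    simp only [Subtype.mk.injEq, Prod.mk.injEq] at h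
    obtain ⟨rfl, rfl⟩ := hf.un _ _ _ _ h.2
    have h1 := h.1
    rw [smul_left_cancel_iff] at h1
    simp [h1]
  · rintro ⟨⟨w, g⟩, h⟩
    have hg : g ≠ 0 := by
      rintro rfl
      apply hQ
      convert h using 1
      ext v; simp
    have hw : w ≠ 0 := by
      rintro rfl
      apply hQ
      convert h using 1
      ext v; simp
    obtain ⟨c, j, rfl⟩ := hf.ex g hg
    refine ⟨⟨c, ⟨(j, c • w), ?_, ?_⟩⟩, ?_⟩
    · exact (smul_ne_zero_iff_ne c).2 hw
    · have := lh_smulRight c (f j) (c • w)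
      rw [inv_smul_smul] at this
      simp only at h ⊢
      rwa [← this]
    · simp

lemma lh_dist_eq [DecidableEq K] [FiniteDimensional F V] [FiniteDimensional F K]
    (f : Fin n → Dual F V) (hf : LhProj f) (x : Fin n → K) :
    distToCode {x : Fin n → K | lhT f x = 0} x = lhRk (lhT f x) := by
  have hle : ∀ k, ∀ x : Fin n → K, lhRk (lhT f x) = k →
      ∃ c, lhT f c = 0 ∧ hammingDist x c ≤ k := by
    intro k
    induction k with
    | zero =>
      intro x hx
      exact ⟨x, (lhRk_eq_zero _).1 hx, by simp⟩
    | succ k ih =>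
      intro x hx
      have hne : lhT f x ≠ 0 := by
        intro h
        rw [(lhRk_eq_zero _).2 h] at hx
        omega
      obtain ⟨u, hu⟩ : ∃ u, lhT f x u ≠ 0 := by
        by_contra! h
        exact hne (LinearMap.ext h)
      have hnk : u ∉ LinearMap.ker (lhT f x) := hu
      obtain ⟨g, hgu, hg⟩ := Submodule.exists_le_ker_of_notMem hnk
      have hd := (lh_down_iff (lhT f x) (lhT f x u) (-(g u)⁻¹ • g)).2 ⟨by
        rw [Submodule.mem_dualAnnihilator]
        intro v hv
        have : g v = 0 := hg hv
        simp [this], u, rfl, by simp [hgu]⟩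
      obtain ⟨c, j, hcj⟩ := hf.ex (-(g u)⁻¹ • g) (by
        intro h
        have := LinearMap.congr_fun h u
        simp [hgu] at this)
      rw [hcj, ← inv_smul_smul c (lhT f x u), lh_smulRight, ← lhT_add_single] at hd
      obtain ⟨y, hy, hxy⟩ := ih (x + Pi.single j (c • (lhT f x) u)) (by omega)
      refine ⟨y, hy, ?_⟩
      have h1 := hammingDist_triangle x (x + Pi.single j (c • (lhT f x) u)) y
      rw [lh_hammingDist_single x j ((smul_ne_zero_iff_ne c).2 hu)] at h1
      omega
  obtain ⟨c, hc, hxc⟩ := hle _ x rfl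
  unfold distToCode
  apply le_antisymm
  · exact le_trans (Nat.sInf_le ⟨c, hc, rfl⟩) hxc
  · refine le_csInf ⟨_, c, hc, rfl⟩ ?_
    rintro _ ⟨y, hy, rfl⟩
    rw [hammingDist_comm, hammingDist_eq_hammingNorm]
    have h := lhRk_le_norm f (-y + x)
    rw [lhT_sub, show lhT f y = 0 from hy] at h
    simpa using h

lemma lh_exists_rank [DecidableEq K] [FiniteDimensional F V] [FiniteDimensional F K]
    (f : Fin n → Dual F V) (hf : LhProj f) (k : ℕ) (hk : k ≤ min (finrank F K) (finrank F V)) :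
    ∃ x : Fin n → K, lhRk (lhT f x) = k := by
  induction k with
  | zero => exact ⟨0, (lhRk_eq_zero _).2 (by ext v; simp [lhT_apply])⟩
  | succ k ih =>
    obtain ⟨x, hx⟩ := ih (by omega)
    have h1 : ∃ w, w ∉ LinearMap.range (lhT f x) := by
      by_contra! h
      have : LinearMap.range (lhT f x) = ⊤ := by
        rw [eq_top_iff]; exact fun w _ => h w
      rw [lhRk, this, finrank_top] at hx
      omega
    have h2 : ∃ g, g ∉ (LinearMap.ker (lhT f x)).dualAnnihilator := by
      by_contra! h
      have : (LinearMap.ker (lhT f x)).dualAnnihilator = ⊤ := by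
        rw [eq_top_iff]; exact fun w _ => h w
      rw [← lh_ann_finrank, this, finrank_top, Subspace.dual_finrank_eq] at hx
      omega
    obtain ⟨w, hw⟩ := h1
    obtain ⟨g, hg⟩ := h2
    have hu := (lh_up_iff _ w g).2 ⟨hw, hg⟩
    obtain ⟨c, j, rfl⟩ := hf.ex g (by rintro rfl; exact hg (Submodule.zero_mem _))
    rw [← inv_smul_smul c w, lh_smulRight, ← lhT_add_single] at hu
    exact ⟨_, by rw [hu, hx]⟩

end Code

lemma lh_proj_of_cols {q m n : ℕ} (F : Type) [Field F] [Fintype F]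
    (hq : Fintype.card F = q)
    (H : Matrix (Fin m) (Fin n) F)
    (hcols : ∀ j, (fun i => H i j) ≠ 0)
    (hind : ∀ j₁ j₂, j₁ ≠ j₂ → ∀ c : F, (fun i => H i j₂) ≠ c • (fun i => H i j₁))
    (hn : n * (q - 1) = q ^ m - 1) :
    LhProj (fun j => dotProductEquiv F (Fin m) (fun i => H i j)) := by
  classical
  have un : ∀ (c c' : Fˣ) (j j' : Fin n),
      c • (fun i => H i j) = c' • (fun i => H i j') → c = c' ∧ j = j' := by
    intro c c' j j' h
    have hj : j = j' := by
      by_contra hne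
      apply hind j j' hne (c'⁻¹ * c : Fˣ)
      rw [← Units.smul_def, mul_smul, h, inv_smul_smul]
    subst hj
    refine ⟨?_, rfl⟩
    obtain ⟨i, hi⟩ := Function.ne_iff.1 (hcols j)
    have := congr_fun h i
    simp only [Pi.smul_apply, Units.smul_def, smul_eq_mul] at this
    exact Units.ext (mul_right_cancel₀ hi this)
  let Φ : Fˣ × Fin n → {v : Fin m → F // v ≠ 0} :=
    fun p => ⟨p.1 • (fun i => H i p.2), by
      rw [Ne, smul_eq_zero_iff_eq]; exact hcols p.2⟩
  have hΦ : Function.Bijective Φ := by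
    rw [Fintype.bijective_iff_injective_and_card]
    constructor
    · rintro ⟨c, j⟩ ⟨c', j'⟩ h
      obtain ⟨rfl, rfl⟩ := un c c' j j' (congr_arg Subtype.val h)
      rfl
    · rw [Fintype.card_prod, Fintype.card_units, Fintype.card_subtype_compl]
      simp [hq, ← hn, mul_comm]
  refine ⟨fun j => ?_, fun g hg => ?_, fun c c' j j' h => un c c' j j' ?_⟩
  · rw [Ne, LinearEquiv.map_eq_zero_iff]; exact hcols j
  · obtain ⟨⟨c, j⟩, h⟩ := hΦ.2 ⟨(dotProductEquiv F (Fin m)).symm g, by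
      rw [Ne, LinearEquiv.map_eq_zero_iff]; exact hg⟩
    refine ⟨c, j, ?_⟩
    have h1 := congr_arg Subtype.val h
    simp only [Φ] at h1
    rw [Units.smul_def] at h1 ⊢
    rw [← map_smul, h1, LinearEquiv.apply_symm_apply]
  · apply (dotProductEquiv F (Fin m)).injective
    simp only [Units.smul_def] at h ⊢
    rw [map_smul, map_smul, h]

/-- The lifted Hamming code `C_{(m,r)}` is completely regular with
covering radius `ρ = min r m` and intersection numbers
`b_i = (q^r−q^i)(q^m−q^i)/(q−1)` and `c_i = q^{i−1}(q^i−1)/(q−1)`. -/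
theorem lifted_hamming_completely_regular {q m r n : ℕ} (hm : 1 ≤ m) (hr : 1 ≤ r)
    (F K : Type) [Field F] [Fintype F] [DecidableEq F]
    [Field K] [Fintype K] [DecidableEq K] [Algebra F K]
    (hq : Fintype.card F = q)
    (hrank : Module.finrank F K = r)
    (H : Matrix (Fin m) (Fin n) F)
    (hcols : ∀ j, (fun i => H i j) ≠ 0)
    (hind : ∀ j₁ j₂, j₁ ≠ j₂ → ∀ c : F, (fun i => H i j₂) ≠ c • (fun i => H i j₁))
    (hn : n * (q - 1) = q ^ m - 1) :
    let C : Set (Fin n → K) := {x | (H.map (algebraMap F K)).mulVec x = 0}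
    (sSup {d : ℕ | ∃ v : Fin n → K, distToCode C v = d} = min r m) ∧
    (∀ i < min r m, ∀ x : Fin n → K, distToCode C x = i →
      Nat.card {y : Fin n → K // hammingDist x y = 1 ∧ distToCode C y = i + 1} =
        (q ^ r - q ^ i) * (q ^ m - q ^ i) / (q - 1)) ∧
    (∀ i : ℕ, 1 ≤ i → i ≤ min r m → ∀ x : Fin n → K, distToCode C x = i →
      Nat.card {y : Fin n → K // hammingDist x y = 1 ∧ distToCode C y = i - 1} =
        q ^ (i - 1) * (q ^ i - 1) / (q - 1)) := by
  intro C
  have hf := lh_proj_of_cols F hq H hcols hind hn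
  set f : Fin n → Module.Dual F (Fin m → F) :=
    fun j => dotProductEquiv F (Fin m) (fun i => H i j) with hfdef
  have hfd : FiniteDimensional F K := Module.finite_of_finrank_pos (by omega)
  have hC : C = {x : Fin n → K | lhT f x = 0} := by
    ext x
    show (H.map (algebraMap F K)).mulVec x = 0 ↔ lhT f x = 0
    constructor
    · intro h
      ext i
      have := congr_fun h i
      simpa [lhT_apply, hfdef, Matrix.mulVec, dotProduct, Algebra.smul_def,
        Pi.single_apply] using this
    · intro h
      ext i
      have := LinearMap.congr_fun h (Pi.single i 1)
      simpa [lhT_apply, hfdef, Matrix.mulVec, dotProduct, Algebra.smul_def,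
        Pi.single_apply] using this
  have hd : ∀ x : Fin n → K, distToCode C x = lhRk (lhT f x) := by
    intro x
    rw [hC]
    exact lh_dist_eq f hf x
  simp only [hd]
  have hV : Module.finrank F (Fin m → F) = m := by simp
  have hcF : Nat.card F = q := by rw [Nat.card_eq_fintype_card, hq]
  have hcU : Nat.card Fˣ = q - 1 := by
    rw [Nat.card_units, hcF]
  have hq1 : 1 < q := hq ▸ Fintype.one_lt_card
  refine ⟨?_, ?_, ?_⟩
  · apply IsGreatest.csSup_eq
    constructor
    · exact lh_exists_rank f hf (min r m) (by rw [hV, hrank])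
    · rintro _ ⟨x, rfl⟩
      refine le_min ?_ ?_
      · rw [← hrank]; exact Submodule.finrank_le _
      · have h := LinearMap.finrank_range_add_finrank_ker (lhT f x)
        rw [hV] at h
        unfold lhRk
        omega
  · rintro i hi x rfl
    have h := lh_card_mul f hf x (fun φ => lhRk φ = lhRk (lhT f x) + 1) (by simp)
    rw [lh_card_up, hcU, hcF, hV, hrank] at h
    exact Nat.eq_div_of_mul_eq_right (by omega) h
  · rintro i hi1 hi x rfl
    have h := lh_card_mul f hf x (fun φ => lhRk φ = lhRk (lhT f x) - 1) (by omega)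
    have he : ∀ φ : (Fin m → F) →ₗ[F] K,
        lhRk φ = lhRk (lhT f x) - 1 ↔ lhRk φ + 1 = lhRk (lhT f x) := by
      intro φ; omega
    simp only [he] at h ⊢
    rw [lh_card_down, hcU, hcF, mul_comm (q ^ _ - 1)] at h
    exact Nat.eq_div_of_mul_eq_right (by omega) h
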